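/- arXiv:math/9603217 — 3 statements merged into one kernel-verified Lean document; each statement's English description precedes it below -/
import Mathlib

section
/- Jacobi sum representation of the Weinstein functions: for 0 ≤ k ≤ n, the coefficient Λ_k^n(t) of z^{n+1} in the power series expansion of W_k(z,t) := e^t w(z,t)^{k+1}/(1 − w(z,t)²), where w(z,t) is the Löwner chain of the Koebe function, equals e^{−kt} ∑_{j=0}^{n−k} P_j^{(2k,0)}(1 − 2e^{−t}). -/
open Finset Real
/-- Generalized binomial coefficient `a` choose `k`. -/
noncomputable def rbinom (a : ℝ) (k : ℕ) : ℝ :=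
  (∏ i ∈ Finset.range k, (a - i)) / (k.factorial : ℝ)

/-- The Jacobi polynomial `P_j^{(α,β)}(x)` via the standard explicit formula. -/
noncomputable def jacobi (α β : ℝ) (j : ℕ) (x : ℝ) : ℝ :=
  ∑ m ∈ Finset.range (j + 1),
    rbinom ((j : ℝ) + α) (j - m) * rbinom ((j : ℝ) + β) m *
      ((x - 1) / 2) ^ m * ((x + 1) / 2) ^ (j - m)


namespace WeinsteinJacobi

/-- The coefficient of `u^j` in `(1 + (1 - y) u)^(j + d) (1 - y u)^j`, which equals the Jacobi
polynomial `P_j^{(d,0)}(1 - 2 y)`. -/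
noncomputable def jacobiCoeff (y : ℝ) (d j : ℕ) : ℝ :=
  ((1 + Polynomial.C (1 - y) * Polynomial.X) ^ (j + d) *
    (1 + Polynomial.C (-y) * Polynomial.X) ^ j : Polynomial ℝ).coeff j

lemma rbinom_natCast (n k : ℕ) : rbinom n k = n.choose k := by
  rw [rbinom, ← descPochhammer_eval_eq_prod_range, descPochhammer_eval_eq_descFactorial,
    Nat.descFactorial_eq_factorial_mul_choose]
  have : (k.factorial : ℝ) ≠ 0 := by positivity
  push_cast
  field_simp

lemma coeff_one_add_C_mul_X_pow (a : ℝ) (n m : ℕ) :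
    ((1 + Polynomial.C a * Polynomial.X) ^ n : Polynomial ℝ).coeff m = n.choose m * a ^ m := by
  have h : (1 + Polynomial.C a * Polynomial.X : Polynomial ℝ) ^ n =
      ((1 + Polynomial.X) ^ n : Polynomial ℝ).comp (Polynomial.C a * Polynomial.X) := by
    simp
  rw [h, Polynomial.comp_C_mul_X_coeff, Polynomial.coeff_one_add_X_pow]

lemma jacobi_eq_jacobiCoeff (y : ℝ) (k j : ℕ) :
    jacobi (2 * k) 0 j (1 - 2 * y) = jacobiCoeff y (2 * k) j := by
  rw [jacobi, jacobiCoeff, mul_comm (_ ^ (j + 2 * k)), Polynomial.coeff_mul,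
    Finset.Nat.sum_antidiagonal_eq_sum_range_succ_mk]
  refine Finset.sum_congr rfl fun m _ => ?_
  have h1 : (j : ℝ) + 2 * k = ((j + 2 * k : ℕ) : ℝ) := by push_cast; ring
  rw [h1, add_zero, rbinom_natCast, rbinom_natCast, coeff_one_add_C_mul_X_pow,
    coeff_one_add_C_mul_X_pow]
  have h2 : (1 - 2 * y - 1) / 2 = -y := by ring
  have h3 : (1 - 2 * y + 1) / 2 = 1 - y := by ring
  rw [h2, h3]
  ring

lemma jacobiCoeff_zero (y : ℝ) (d : ℕ) : jacobiCoeff y d 0 = 1 := by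
  simp [jacobiCoeff, Polynomial.coeff_zero_eq_eval_zero]

lemma jacobiCoeff_contiguous (y : ℝ) (d j : ℕ) :
    y * jacobiCoeff y (d + 2) j =
      jacobiCoeff y d (j + 1) - jacobiCoeff y (d + 1) (j + 1) + jacobiCoeff y (d + 1) j := by
  have h : (Polynomial.C y * (Polynomial.X * ((1 + Polynomial.C (1 - y) * Polynomial.X) ^
        (j + (d + 2)) * (1 + Polynomial.C (-y) * Polynomial.X) ^ j)) : Polynomial ℝ) =
      (1 + Polynomial.C (1 - y) * Polynomial.X) ^ (j + 1 + d) *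
        (1 + Polynomial.C (-y) * Polynomial.X) ^ (j + 1) -
      (1 + Polynomial.C (1 - y) * Polynomial.X) ^ (j + 1 + (d + 1)) *
        (1 + Polynomial.C (-y) * Polynomial.X) ^ (j + 1) +
      Polynomial.X * ((1 + Polynomial.C (1 - y) * Polynomial.X) ^ (j + (d + 1)) *
        (1 + Polynomial.C (-y) * Polynomial.X) ^ j) := by
    simp only [Polynomial.C_sub, Polynomial.C_neg, Polynomial.C_1]
    ring
  have h_coeff := congrArg (fun p => Polynomial.coeff p (j + 1)) h
  simpa only [Polynomial.coeff_C_mul, Polynomial.coeff_X_mul, Polynomial.coeff_add,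
    Polynomial.coeff_sub, jacobiCoeff] using h_coeff

/-- The quadratic polynomial `1 + B u + A u²`. -/
noncomputable def trinomial (A B : ℝ) : Polynomial ℝ :=
  1 + Polynomial.C B * Polynomial.X + Polynomial.C A * Polynomial.X ^ 2

lemma derivative_trinomial_pow (A B : ℝ) (n : ℕ) :
    Polynomial.derivative (trinomial A B ^ (n + 1)) =
      Polynomial.C ((n : ℝ) + 1) * (Polynomial.C B * trinomial A B ^ n +
        Polynomial.C (2 * A) * (Polynomial.X * trinomial A B ^ n)) := by
  rw [Polynomial.derivative_pow_succ]
  have : Polynomial.derivative (trinomial A B) =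
      Polynomial.C B + Polynomial.C (2 * A) * Polynomial.X := by
    simp [trinomial, map_ofNat]
    ring
  rw [this]
  simp
  ring

lemma coeff_trinomial_pow_succ (A B : ℝ) (n : ℕ) :
    (trinomial A B ^ (n + 1)).coeff (n + 1) =
      B * (trinomial A B ^ n).coeff n +
        2 * A * (Polynomial.X * trinomial A B ^ n).coeff n := by
  have h := congrArg (fun p => Polynomial.coeff p n) (derivative_trinomial_pow A B n)
  simp only [Polynomial.coeff_derivative, Polynomial.coeff_C_mul, Polynomial.coeff_add] at h
  have hn : (n : ℝ) + 1 ≠ 0 := by positivity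
  apply mul_right_cancel₀ hn
  linear_combination h

lemma coeff_X_mul_trinomial_pow_succ (A B : ℝ) (n : ℕ) :
    (n + 2) * (Polynomial.X * trinomial A B ^ (n + 1)).coeff (n + 1) =
      2 * (n + 1) * (trinomial A B ^ n).coeff n +
        (n + 1) * B * (Polynomial.X * trinomial A B ^ n).coeff n := by
  have h := congrArg (fun p => Polynomial.coeff (Polynomial.X * p) n)
    (derivative_trinomial_pow A B n)
  have hl : (Polynomial.X * Polynomial.derivative (trinomial A B ^ (n + 1))).coeff n =
      n * (trinomial A B ^ (n + 1)).coeff n := by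
    cases n with
    | zero => simp
    | succ n => rw [Polynomial.coeff_X_mul, Polynomial.coeff_derivative]; push_cast; ring
  have hr : (Polynomial.X * (Polynomial.C ((n : ℝ) + 1) * (Polynomial.C B * trinomial A B ^ n +
        Polynomial.C (2 * A) * (Polynomial.X * trinomial A B ^ n)))) =
      Polynomial.C ((n : ℝ) + 1) * (Polynomial.C B * (Polynomial.X * trinomial A B ^ n) +
        Polynomial.C (2 * A) * (Polynomial.X ^ 2 * trinomial A B ^ n)) := by ring
  have hp : trinomial A B ^ (n + 1) = trinomial A B ^ n +
      Polynomial.C B * (Polynomial.X * trinomial A B ^ n) +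
        Polynomial.C A * (Polynomial.X ^ 2 * trinomial A B ^ n) := by
    rw [pow_succ]
    generalize trinomial A B ^ n = p
    rw [trinomial]
    ring
  have hc := congrArg (fun p => Polynomial.coeff p n) hp
  simp only [Polynomial.coeff_C_mul, Polynomial.coeff_add] at hc
  simp only [hl, hr, Polynomial.coeff_C_mul, Polynomial.coeff_add] at h
  rw [Polynomial.coeff_X_mul]
  linear_combination 2 * (n + 1) * hc - h

lemma trinomial_recurrence (A B : ℝ) (n : ℕ) :
    (n + 2) * (trinomial A B ^ (n + 2)).coeff (n + 2) =
      (2 * n + 3) * B * (trinomial A B ^ (n + 1)).coeff (n + 1) -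
        (n + 1) * (B ^ 2 - 4 * A) * (trinomial A B ^ n).coeff n := by
  linear_combination (n + 2) * coeff_trinomial_pow_succ A B (n + 1) +
    2 * A * coeff_X_mul_trinomial_pow_succ A B n - (n + 1) * B * coeff_trinomial_pow_succ A B n

lemma jacobiCoeff_eq_trinomial (y : ℝ) (n : ℕ) :
    jacobiCoeff y 0 n = (trinomial (-(y * (1 - y))) (1 - 2 * y) ^ n).coeff n := by
  rw [jacobiCoeff, add_zero, ← mul_pow]
  congr 2
  simp only [trinomial, Polynomial.C_sub, Polynomial.C_neg, Polynomial.C_1, Polynomial.C_mul,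
    map_ofNat]
  ring

lemma legendre_recurrence (y : ℝ) (n : ℕ) :
    (n + 2) * jacobiCoeff y 0 (n + 2) =
      (2 * n + 3) * (1 - 2 * y) * jacobiCoeff y 0 (n + 1) - (n + 1) * jacobiCoeff y 0 n := by
  simp only [jacobiCoeff_eq_trinomial]
  linear_combination trinomial_recurrence (-(y * (1 - y))) (1 - 2 * y) n

lemma jacobiCoeff_one_eq (y : ℝ) (j : ℕ) :
    2 * y * jacobiCoeff y 1 j = jacobiCoeff y 0 j - jacobiCoeff y 0 (j + 1) := by
  have h : (Polynomial.C (2 * y) * ((1 + Polynomial.C (1 - y) * Polynomial.X) ^ (j + 1) *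
      (1 + Polynomial.C (-y) * Polynomial.X) ^ j) : Polynomial ℝ) =
      Polynomial.C (2 * y) * trinomial (-(y * (1 - y))) (1 - 2 * y) ^ j -
        Polynomial.C (2 * (-(y * (1 - y)))) *
          (Polynomial.X * trinomial (-(y * (1 - y))) (1 - 2 * y) ^ j) := by
    have : trinomial (-(y * (1 - y))) (1 - 2 * y) =
        (1 + Polynomial.C (1 - y) * Polynomial.X) * (1 + Polynomial.C (-y) * Polynomial.X) := by
      simp only [trinomial, Polynomial.C_sub, Polynomial.C_neg, Polynomial.C_1, Polynomial.C_mul,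
        map_ofNat]
      ring
    rw [this, mul_pow]
    simp only [Polynomial.C_sub, Polynomial.C_neg, Polynomial.C_1, Polynomial.C_mul, map_ofNat]
    ring
  have h_coeff := congrArg (fun p => Polynomial.coeff p j) h
  simp only [Polynomial.coeff_C_mul, Polynomial.coeff_sub] at h_coeff
  rw [jacobiCoeff_eq_trinomial, jacobiCoeff_eq_trinomial, coeff_trinomial_pow_succ, jacobiCoeff, h_coeff]
  ring

/-- The power series of `(1 - e X)^(-1/2)`. -/
noncomputable def invSqrtSeries (e : ℂ) : PowerSeries ℂ :=
  PowerSeries.mk fun n => (n.centralBinom / 4 ^ n : ℂ) * e ^ n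

lemma derivative_invSqrtSeries (e : ℂ) :
    2 * (1 - PowerSeries.C e * PowerSeries.X) * PowerSeries.derivative ℂ (invSqrtSeries e) =
      PowerSeries.C e * invSqrtSeries e := by
  have key (n : ℕ) : 2 * (n + 1) * (invSqrtSeries e).coeff (n + 1) =
      (2 * n + 1) * e * (invSqrtSeries e).coeff n := by
    have h : ((n : ℂ) + 1) * (n + 1).centralBinom = 2 * (2 * n + 1) * n.centralBinom := by
      exact_mod_cast Nat.succ_mul_centralBinom_succ n
    simp only [invSqrtSeries, PowerSeries.coeff_mk]
    rw [pow_succ, pow_succ]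
    field_simp
    linear_combination 2 * e ^ n * e * h
  have : 2 * (1 - PowerSeries.C e * PowerSeries.X) * PowerSeries.derivative ℂ (invSqrtSeries e) =
      PowerSeries.C 2 * PowerSeries.derivative ℂ (invSqrtSeries e) - PowerSeries.C (2 * e) *
        (PowerSeries.X * PowerSeries.derivative ℂ (invSqrtSeries e)) := by
    simp only [map_mul, map_ofNat]
    ring
  rw [this]
  ext n
  cases n with
  | zero =>
    simp only [map_sub, PowerSeries.coeff_C_mul, PowerSeries.coeff_zero_X_mul,
      PowerSeries.coeff_derivative]
    have := key 0
    push_cast at this ⊢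
    linear_combination this
  | succ n =>
    simp only [map_sub, PowerSeries.coeff_C_mul, PowerSeries.coeff_succ_X_mul,
      PowerSeries.coeff_derivative]
    push_cast
    have := key (n + 1)
    push_cast at this
    linear_combination this

lemma invSqrtSeries_sq (e : ℂ) :
    invSqrtSeries e * invSqrtSeries e * (1 - PowerSeries.C e * PowerSeries.X) = 1 := by
  apply PowerSeries.derivative.ext
  · simp only [Derivation.leibniz, map_sub, PowerSeries.derivative_C, PowerSeries.derivative_X,
      smul_eq_mul, Derivation.map_one_eq_zero]
    linear_combination invSqrtSeries e * derivative_invSqrtSeries e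
  · simp [invSqrtSeries]

lemma coeff_invSqrtSeries_sq (e : ℂ) (n : ℕ) :
    (invSqrtSeries e * invSqrtSeries e).coeff n = e ^ n := by
  have h := invSqrtSeries_sq e
  have h2 : (PowerSeries.mk fun n => e ^ n) * (1 - PowerSeries.C e * PowerSeries.X) = 1 := by
    ext n
    rw [mul_sub, mul_one, mul_left_comm]
    cases n with
    | zero => simp
    | succ n => simp [PowerSeries.coeff_succ_mul_X, PowerSeries.coeff_one, pow_succ']
  have h3 : invSqrtSeries e * invSqrtSeries e = PowerSeries.mk fun n => e ^ n := by
    have hne : (1 - PowerSeries.C e * PowerSeries.X : PowerSeries ℂ) ≠ 0 := by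
      rintro h0
      rw [h0, mul_zero] at h
      exact zero_ne_one h
    exact mul_right_cancel₀ hne (h.trans h2.symm)
  rw [h3, PowerSeries.coeff_mk]

lemma coeff_invSqrtSeries_mul (y : ℝ) (e f : ℂ) (hs : e + f = 2 * (1 - 2 * y)) (hp : e * f = 1)
    (n : ℕ) : (invSqrtSeries e * invSqrtSeries f).coeff n = jacobiCoeff y 0 n := by
  obtain ⟨x, hx⟩ : ∃ x : ℂ, x = 1 - 2 * y := ⟨_, rfl⟩
  rw [← hx] at hs
  set D := invSqrtSeries e * invSqrtSeries f with hD
  have hode : PowerSeries.derivative ℂ D -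
      PowerSeries.C (2 * x) * (PowerSeries.X * PowerSeries.derivative ℂ D) +
      PowerSeries.X * (PowerSeries.X * PowerSeries.derivative ℂ D) =
      PowerSeries.C x * D - PowerSeries.X * D := by
    have h2 : (2 : PowerSeries ℂ) ≠ 0 := fun h => by
      simpa [map_ofNat] using congrArg (PowerSeries.constantCoeff (R := ℂ)) h
    apply mul_left_cancel₀ h2
    have hs' := congrArg (PowerSeries.C (R := ℂ)) hs
    have hp' := congrArg (PowerSeries.C (R := ℂ)) hp
    rw [hD]
    simp only [Derivation.leibniz, smul_eq_mul]
    simp only [map_add, map_mul, map_one, map_ofNat] at hs' hp' ⊢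
    have he := derivative_invSqrtSeries e
    have hf := derivative_invSqrtSeries f
    linear_combination (1 - PowerSeries.C f * PowerSeries.X) * invSqrtSeries f * he +
      (1 - PowerSeries.C e * PowerSeries.X) * invSqrtSeries e * hf +
      (2 * PowerSeries.X * (invSqrtSeries e * PowerSeries.derivative ℂ (invSqrtSeries f) +
        invSqrtSeries f * PowerSeries.derivative ℂ (invSqrtSeries e)) +
        invSqrtSeries e * invSqrtSeries f) * hs' -
      (2 * PowerSeries.X ^ 2 * (invSqrtSeries e * PowerSeries.derivative ℂ (invSqrtSeries f) +
        invSqrtSeries f * PowerSeries.derivative ℂ (invSqrtSeries e)) +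
        2 * PowerSeries.X * (invSqrtSeries e * invSqrtSeries f)) * hp'
  have hrec (n : ℕ) : (n + 2) * D.coeff (n + 2) =
      (2 * n + 3) * x * D.coeff (n + 1) - (n + 1) * D.coeff n := by
    have h := congrArg (PowerSeries.coeff (n + 1)) hode
    simp only [map_add, map_sub, PowerSeries.coeff_C_mul, PowerSeries.coeff_succ_X_mul,
      PowerSeries.coeff_derivative] at h
    cases n with
    | zero =>
      simp only [PowerSeries.coeff_zero_X_mul] at h
      push_cast at h ⊢
      linear_combination h
    | succ n =>
      simp only [PowerSeries.coeff_succ_X_mul, PowerSeries.coeff_derivative] at h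
      push_cast at h ⊢
      linear_combination h
  have h0 : D.coeff 0 = jacobiCoeff y 0 0 := by
    simp [hD, invSqrtSeries, jacobiCoeff_zero]
  have h1 : D.coeff 1 = jacobiCoeff y 0 1 := by
    have h := congrArg (PowerSeries.coeff 0) hode
    have h_coeff := coeff_trinomial_pow_succ (-(y * (1 - y))) (1 - 2 * y) 0
    rw [← jacobiCoeff_eq_trinomial] at h_coeff
    simp only [map_add, map_sub, PowerSeries.coeff_C_mul, PowerSeries.coeff_zero_X_mul,
      PowerSeries.coeff_derivative, h0, jacobiCoeff_zero] at h
    simp only [pow_zero, mul_one, Polynomial.coeff_one_zero, Polynomial.coeff_X_zero, mul_zero,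
      add_zero] at h_coeff
    rw [h_coeff]
    push_cast at h ⊢
    linear_combination h + hx
  induction n using Nat.twoStepInduction with
  | zero => exact h0
  | one => exact h1
  | more n ih ih' =>
    have hn : (n : ℂ) + 2 ≠ 0 := by exact_mod_cast (by omega : n + 2 ≠ 0)
    apply mul_left_cancel₀ hn
    rw [hrec, ih, ih', hx]
    exact_mod_cast (legendre_recurrence y n).symm

lemma norm_coeff_invSqrtSeries_le (e : ℂ) (he : ‖e‖ = 1) (n : ℕ) :
    ‖(invSqrtSeries e).coeff n‖ ≤ 1 := by
  have h : (n.centralBinom : ℝ) ≤ 4 ^ n := by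
    exact_mod_cast (Nat.choose_le_two_pow (2 * n) n).trans_eq (by rw [pow_mul]; norm_num)
  simp only [invSqrtSeries, PowerSeries.coeff_mk, norm_mul, norm_pow, he, one_pow, mul_one,
    norm_div, Complex.norm_natCast, Complex.norm_ofNat]
  exact div_le_one_of_le₀ h (by positivity)

lemma summable_norm_invSqrtSeries (e z : ℂ) (he : ‖e‖ = 1) (hz : ‖z‖ < 1) :
    Summable fun n => ‖(invSqrtSeries e).coeff n * z ^ n‖ := by
  refine Summable.of_nonneg_of_le (fun _ => norm_nonneg _) (fun n => ?_)
    (summable_geometric_of_lt_one (norm_nonneg z) hz)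
  rw [norm_mul, norm_pow]
  exact mul_le_of_le_one_left (by positivity) (norm_coeff_invSqrtSeries_le e he n)

lemma hasSum_coeff_mul {p q : PowerSeries ℂ} {z : ℂ}
    (hp : Summable fun n => ‖p.coeff n * z ^ n‖) (hq : Summable fun n => ‖q.coeff n * z ^ n‖) :
    HasSum (fun n => (p * q).coeff n * z ^ n)
      ((∑' n, p.coeff n * z ^ n) * ∑' n, q.coeff n * z ^ n) := by
  have heq (n : ℕ) : (p * q).coeff n * z ^ n =
      ∑ ij ∈ Finset.HasAntidiagonal.antidiagonal n, p.coeff ij.1 * z ^ ij.1 * (q.coeff ij.2 * z ^ ij.2) := by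
    rw [PowerSeries.coeff_mul, Finset.sum_mul]
    refine Finset.sum_congr rfl fun ij hij => ?_
    rw [← Finset.HasAntidiagonal.mem_antidiagonal.mp hij, pow_add]
    ring
  simp only [heq]
  rw [tsum_mul_tsum_eq_tsum_sum_antidiagonal_of_summable_norm hp hq]
  exact (summable_norm_sum_mul_antidiagonal_of_summable_norm hp hq).of_norm.hasSum

/-- The generating function of the Legendre polynomials. -/
lemma hasSum_legendre (y z : ℝ) (hy : y ∈ Set.Icc (0 : ℝ) 1) (hz : |z| < 1) :
    HasSum (fun n => jacobiCoeff y 0 n * z ^ n) (Real.sqrt ((1 - z) ^ 2 + 4 * y * z))⁻¹ := by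
  obtain ⟨hy0, hy1⟩ := hy
  set v := Real.sqrt (y * (1 - y)) with hv
  have hv2 : v ^ 2 = y * (1 - y) := Real.sq_sqrt (mul_nonneg hy0 (by linarith))
  set e : ℂ := ⟨1 - 2 * y, 2 * v⟩ with he
  set f : ℂ := starRingEnd ℂ e with hf
  have hnormSq : Complex.normSq e = 1 := by
    simp only [Complex.normSq_apply, he]
    linear_combination 4 * hv2
  have hne : ‖e‖ = 1 := by
    rw [← sq_eq_sq₀ (norm_nonneg e) zero_le_one, ← Complex.normSq_eq_norm_sq, hnormSq, one_pow]
  have hnf : ‖f‖ = 1 := by rw [hf, Complex.norm_conj, hne]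
  have hs : e + f = 2 * (1 - 2 * y) := by
    apply Complex.ext <;> simp [hf, he]; ring
  have hp : e * f = 1 := by rw [hf, Complex.mul_conj, hnormSq, Complex.ofReal_one]
  have hz' : ‖(z : ℂ)‖ < 1 := by simpa using hz
  have se := summable_norm_invSqrtSeries e z hne hz'
  have sf := summable_norm_invSqrtSeries f z hnf hz'
  set a := ∑' n, (invSqrtSeries e).coeff n * (z : ℂ) ^ n with ha
  have hb : ∑' n, (invSqrtSeries f).coeff n * (z : ℂ) ^ n = starRingEnd ℂ a := by
    rw [ha, Complex.conj_tsum]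
    refine tsum_congr fun n => ?_
    simp [invSqrtSeries, hf, map_ofNat]
  have hF := hasSum_coeff_mul se sf
  simp only [coeff_invSqrtSeries_mul y e f hs hp, hb] at hF
  rw [← ha, Complex.mul_conj] at hF
  have hsq := hasSum_coeff_mul se se
  simp only [coeff_invSqrtSeries_sq, ← mul_pow] at hsq
  have hez : ‖e * z‖ < 1 := by rwa [norm_mul, hne, one_mul]
  have haa : a * a = (1 - e * z)⁻¹ := hsq.unique (hasSum_geometric_of_norm_lt_one hez)
  have hval : Complex.normSq a ^ 2 = ((1 - z) ^ 2 + 4 * y * z)⁻¹ := by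
    rw [sq, ← Complex.normSq_mul, haa, Complex.normSq_inv]
    congr 1
    simp [Complex.normSq_apply, he]
    linear_combination 4 * z ^ 2 * hv2
  have hfin : Complex.normSq a = (Real.sqrt ((1 - z) ^ 2 + 4 * y * z))⁻¹ := by
    rw [← Real.sqrt_inv, ← hval, Real.sqrt_sq (Complex.normSq_nonneg a)]
  rw [← hfin]
  exact_mod_cast hF

lemma hasSum_of_eq {f g : ℕ → ℝ} {a b : ℝ} (h : HasSum f a) (hfg : ∀ n, g n = f n)
    (hab : b = a) : HasSum g b := by
  rwa [funext hfg, hab]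

lemma hasSum_jacobiCoeff (y z : ℝ) (hy : y ∈ Set.Ioc (0 : ℝ) 1) (hz : z ∈ Set.Ioo (0 : ℝ) 1)
    (R : ℝ) (hR : 0 < R) (hR2 : R ^ 2 = (1 - z) ^ 2 + 4 * y * z) (d : ℕ) :
    HasSum (fun j => jacobiCoeff y d j * z ^ j) ((2 / (1 - z + R)) ^ d / R) := by
  obtain ⟨hy0, hy1⟩ := hy
  obtain ⟨hz0, hz1⟩ := hz
  have hpos : 0 < 1 - z + R := by linarith
  have hshift {d : ℕ} {g : ℝ} (h : HasSum (fun j => jacobiCoeff y d j * z ^ j) g) :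
      HasSum (fun j => jacobiCoeff y d (j + 1) * z ^ (j + 1)) (g - 1) := by
    have := (hasSum_nat_add_iff' 1).mpr h
    simpa [jacobiCoeff_zero] using this
  induction d using Nat.twoStepInduction with
  | zero =>
    have h := hasSum_legendre y z ⟨hy0.le, hy1⟩ (by rwa [abs_of_pos hz0])
    rw [← hR2, Real.sqrt_sq hR.le] at h
    simpa using h
  | one =>
    have h := hasSum_legendre y z ⟨hy0.le, hy1⟩ (by rwa [abs_of_pos hz0])
    rw [← hR2, Real.sqrt_sq hR.le] at h
    refine hasSum_of_eq (((h.mul_left z).sub (hshift h)).mul_left (1 / (2 * y * z))) (fun j => ?_) ?_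
    · field_simp
      linear_combination z ^ j * z * jacobiCoeff_one_eq y j
    · field_simp
      linear_combination (-1 : ℝ) * hR2
  | more d ih ih' =>
    refine hasSum_of_eq ((((hshift ih).sub (hshift ih')).add (ih'.mul_left z)).mul_left (1 / (y * z))) (fun j => ?_) ?_
    · field_simp
      linear_combination z ^ j * z * jacobiCoeff_contiguous y d j
    · have hs : y * z * (2 / (1 - z + R)) ^ 2 = 1 - (1 - z) * (2 / (1 - z + R)) := by
        field_simp
        linear_combination (-1 : ℝ) * hR2
      generalize 2 / (1 - z + R) = s at *
      field_simp
      rw [pow_add, pow_succ]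
      linear_combination s ^ d * hs

end WeinsteinJacobi

/-- Jacobi sum representation of the Weinstein functions: the coefficient of
`z^{n+1}` (here `n = m + k`) in `W_k(z,t) = eᵗ w^{k+1}/(1-w²)` equals
`e^{-kt} ∑_{j=0}^{n-k} P_j^{(2k,0)}(1-2e^{-t})`. -/
theorem weinstein_jacobi_sum (t : ℝ) (ht : 0 ≤ t) (k : ℕ)
    (z : ℝ) (hz : z ∈ Set.Ioo (0 : ℝ) 1) :
    HasSum
      (fun m : ℕ =>
        Real.exp (-(k : ℝ) * t) *
          (∑ j ∈ Finset.range (m + 1), jacobi (2 * k) 0 j (1 - 2 * Real.exp (-t))) *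
          z ^ (m + k + 1))
      (Real.exp t *
        ((4 * Real.exp (-t) * z /
            (1 - z + Real.sqrt (1 - 2 * (1 - 2 * Real.exp (-t)) * z + z ^ 2)) ^ 2) ^ (k + 1) /
          (1 - (4 * Real.exp (-t) * z /
            (1 - z + Real.sqrt (1 - 2 * (1 - 2 * Real.exp (-t)) * z + z ^ 2)) ^ 2) ^ 2))) := by
  set y := Real.exp (-t) with hy
  have hy0 : 0 < y := Real.exp_pos _
  have hy1 : y ≤ 1 := Real.exp_le_one_iff.mpr (by linarith)
  obtain ⟨hz0, hz1⟩ := hz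
  have hr : 0 < 1 - 2 * (1 - 2 * y) * z + z ^ 2 := by nlinarith [mul_pos hy0 hz0, sq_nonneg (1 - z)]
  set R := Real.sqrt (1 - 2 * (1 - 2 * y) * z + z ^ 2) with hRdef
  have hR : 0 < R := Real.sqrt_pos.mpr hr
  have hR2 : R ^ 2 = (1 - z) ^ 2 + 4 * y * z := by rw [hRdef, Real.sq_sqrt hr.le]; ring
  have hG := WeinsteinJacobi.hasSum_jacobiCoeff y z ⟨hy0, hy1⟩ ⟨hz0, hz1⟩ R hR hR2 (2 * k)
  have hgeo := hasSum_geometric_of_lt_one hz0.le hz1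
  have hC := hasSum_sum_range_mul_of_summable_norm hG.summable.norm hgeo.summable.norm
  rw [hG.tsum_eq, hgeo.tsum_eq] at hC
  have hpos : 0 < 1 - z + R := by linarith
  have hz' : 0 < 1 - z := by linarith
  have ht' : Real.exp t = 1 / y := by rw [hy, Real.exp_neg]; simp
  have hk : Real.exp (-(k : ℝ) * t) = y ^ k := by
    rw [hy, ← Real.exp_nat_mul]; congr 1; ring
  refine WeinsteinJacobi.hasSum_of_eq (hC.mul_left (y ^ k * z ^ (k + 1))) (fun m => ?_) ?_
  · have : ∀ j ∈ Finset.range (m + 1), WeinsteinJacobi.jacobiCoeff y (2 * k) j * z ^ j * z ^ (m - j) =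
        WeinsteinJacobi.jacobiCoeff y (2 * k) j * z ^ m := fun j hj => by
      rw [mul_assoc, ← pow_add, Nat.add_sub_cancel' (Finset.mem_range_succ_iff.mp hj)]
    rw [Finset.sum_congr rfl this, ← Finset.sum_mul, hk]
    simp only [WeinsteinJacobi.jacobi_eq_jacobiCoeff]
    ring
  · have hs : y * z * (2 / (1 - z + R)) ^ 2 = 1 - (1 - z) * (2 / (1 - z + R)) := by
      field_simp
      linear_combination (-1 : ℝ) * hR2
    have hRs : R * (2 / (1 - z + R)) = 2 - (1 - z) * (2 / (1 - z + R)) := by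
      field_simp
      ring
    have hw : 4 * y * z / (1 - z + R) ^ 2 = y * z * (2 / (1 - z + R)) ^ 2 := by
      field_simp
      norm_num
    have hspos : 0 < 2 / (1 - z + R) := by positivity
    rw [hw, ht']
    generalize 2 / (1 - z + R) = s at *
    have hden : 1 - (y * z * s ^ 2) ^ 2 = R * (1 - z) * s ^ 2 := by
      rw [hs]
      linear_combination (-(1 - z) * s) * hRs
    rw [hden]
    field_simp
    ring
end

section
/- Addition theorem for Gegenbauer polynomials: for ν > 1/2, x, y ∈ [−1,1] and ζ ∈ ℂ, C_n^ν(xy + √(1−x²)√(1−y²)·ζ) = Γ(2ν−1) ∑_{j=0}^{n} (4^j (n−j)! / Γ(n+2ν+j)) · ((ν)_j)² · (2ν+2j−1) · (1−x²)^{j/2}(1−y²)^{j/2} · C_{n−j}^{ν+j}(x) C_{n−j}^{ν+j}(y) · C_j^{ν−1/2}(ζ). -/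
open Finset Real
/-- The Gegenbauer (ultraspherical) polynomial `C_n^ν(x)`, via its standard explicit formula. -/
noncomputable def gegenbauer (ν : ℝ) (n : ℕ) (x : ℝ) : ℝ :=
  ∑ m ∈ Finset.range (n / 2 + 1),
    (-1 : ℝ) ^ m * Real.Gamma (ν + (n : ℝ) - m) /
      (Real.Gamma ν * (m.factorial : ℝ) * ((n - 2 * m).factorial : ℝ)) *
        (2 * x) ^ (n - 2 * m)


/-- The Gegenbauer polynomials generated by their three-term recurrence, with the degree shifted by
one: the value at `n + 1` is `C_n^ν(x)`, and the value at `0` is `0`. -/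
noncomputable def gegenbauerRec (ν x : ℝ) : ℕ → ℝ
  | 0 => 0
  | 1 => 1
  | n + 2 => (2 * (n + ν) * x * gegenbauerRec ν x (n + 1) -
      (n + 2 * ν - 1) * gegenbauerRec ν x n) / (n + 1)

theorem gegenbauerRec_zero (ν x : ℝ) : gegenbauerRec ν x 0 = 0 := by
  simp [gegenbauerRec]

theorem gegenbauerRec_one (ν x : ℝ) : gegenbauerRec ν x 1 = 1 := by
  simp [gegenbauerRec]

theorem gegenbauerRec_add_two (ν x : ℝ) (n : ℕ) :
    ((n : ℝ) + 1) * gegenbauerRec ν x (n + 2) =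
      2 * (n + ν) * x * gegenbauerRec ν x (n + 1) - (n + 2 * ν - 1) * gegenbauerRec ν x n := by
  have h : (n : ℝ) + 1 ≠ 0 := by positivity
  rw [gegenbauerRec]
  field_simp

/-- A sequence with the initial values and the recurrence of the Gegenbauer polynomials. -/
theorem eq_gegenbauerRec {ν x : ℝ} {f : ℕ → ℝ} (h0 : f 0 = 0) (h1 : f 1 = 1)
    (h : ∀ n : ℕ, ((n : ℝ) + 1) * f (n + 2) =
      2 * (n + ν) * x * f (n + 1) - (n + 2 * ν - 1) * f n) (n : ℕ) :
    f n = gegenbauerRec ν x n := by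
  induction n using Nat.twoStepInduction with
  | zero => rw [h0, gegenbauerRec_zero]
  | one => rw [h1, gegenbauerRec_one]
  | more n ih ih' =>
    have hn : (n : ℝ) + 1 ≠ 0 := by positivity
    apply mul_left_cancel₀ hn
    rw [h, ih, ih', gegenbauerRec_add_two]

/-- The `m`-th term of the explicit formula for `C_n^ν(x)`, extended by zero. -/
noncomputable def gegenbauerTerm (ν x : ℝ) (n m : ℕ) : ℝ :=
  if 2 * m ≤ n then
    (-1 : ℝ) ^ m * Real.Gamma (ν + (n : ℝ) - m) /
      (Real.Gamma ν * (m.factorial : ℝ) * ((n - 2 * m).factorial : ℝ)) * (2 * x) ^ (n - 2 * m)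
  else 0

theorem gegenbauer_eq_sum_term (ν x : ℝ) {n L : ℕ} (hL : n / 2 < L) :
    gegenbauer ν n x = ∑ m ∈ range L, gegenbauerTerm ν x n m := by
  unfold gegenbauer
  rw [← Finset.sum_subset (Finset.range_subset_range.2 hL)]
  · refine Finset.sum_congr rfl fun m hm => ?_
    rw [Finset.mem_range] at hm
    rw [gegenbauerTerm, if_pos (by omega)]
  · intro m _ hm
    rw [Finset.mem_range] at hm
    rw [gegenbauerTerm, if_neg (by omega)]

theorem gegenbauerTerm_zero_recurrence {ν : ℝ} (hν : 0 < ν) (x : ℝ) (n : ℕ) :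
    ((n : ℝ) + 2) * gegenbauerTerm ν x (n + 2) 0 =
      2 * (n + 1 + ν) * x * gegenbauerTerm ν x (n + 1) 0 := by
  have hΓ := (Real.Gamma_pos_of_pos hν).ne'
  have h1 : Real.Gamma (ν + n + 2) = (ν + n + 1) * Real.Gamma (ν + n + 1) := by
    rw [← Real.Gamma_add_one (by positivity)]; ring_nf
  have hf : (((n + 2).factorial : ℕ) : ℝ) = (n + 2) * ((n + 1).factorial : ℝ) := by
    rw [Nat.factorial_succ]; push_cast; ring
  have h2 : ((n + 1).factorial : ℝ) ≠ 0 := by positivity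
  simp only [gegenbauerTerm, mul_zero, zero_le, if_true, Nat.sub_zero, pow_zero,
    Nat.factorial_zero, Nat.cast_zero, sub_zero, Nat.cast_one, mul_one, one_mul, hf, Nat.cast_add,
    Nat.cast_ofNat, ← add_assoc, h1]
  field_simp
  ring

theorem gegenbauerTerm_succ_recurrence {ν : ℝ} (hν : 0 < ν) (x : ℝ) (n m : ℕ) :
    ((n : ℝ) + 2) * gegenbauerTerm ν x (n + 2) (m + 1) =
      2 * (n + 1 + ν) * x * gegenbauerTerm ν x (n + 1) (m + 1) -
        (n + 2 * ν) * gegenbauerTerm ν x n m := by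
  have hΓ := (Real.Gamma_pos_of_pos hν).ne'
  have hm : ((m + 1).factorial : ℝ) = (m + 1) * (m.factorial : ℝ) := by
    rw [Nat.factorial_succ]; push_cast; ring
  have hm' : (m.factorial : ℝ) ≠ 0 := by positivity
  rcases lt_trichotomy n (2 * m) with h | h | h
  · simp only [gegenbauerTerm]
    rw [if_neg (by omega), if_neg (by omega), if_neg (by omega)]
    ring
  · simp only [gegenbauerTerm]
    rw [if_pos (by omega), if_neg (by omega), if_pos (by omega)]
    subst h
    have e : 2 * m + 2 - 2 * (m + 1) = 0 := by omega
    have h1 : Real.Gamma (ν + (2 * m + 2 : ℕ) - (m + 1 : ℕ)) =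
        (ν + m) * Real.Gamma (ν + (2 * m : ℕ) - m) := by
      push_cast
      rw [show ν + 2 * (m : ℝ) - m = ν + m by ring, ← Real.Gamma_add_one (by positivity)]
      ring_nf
    rw [h1, e, Nat.sub_self, hm]
    push_cast
    field_simp
    ring
  · obtain ⟨r, rfl⟩ := Nat.exists_eq_add_of_lt h
    simp only [gegenbauerTerm]
    rw [if_pos (by omega), if_pos (by omega), if_pos (by omega)]
    have e1 : 2 * m + r + 1 + 2 - 2 * (m + 1) = r + 1 := by omega
    have e2 : 2 * m + r + 1 + 1 - 2 * (m + 1) = r := by omega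
    have e3 : 2 * m + r + 1 - 2 * m = r + 1 := by omega
    have h1 : Real.Gamma (ν + (2 * m + r + 1 + 2 : ℕ) - (m + 1 : ℕ)) =
        (ν + m + r + 1) * Real.Gamma (ν + m + r + 1) := by
      rw [← Real.Gamma_add_one (by positivity)]
      push_cast
      ring_nf
    have h2 : Real.Gamma (ν + (2 * m + r + 1 + 1 : ℕ) - (m + 1 : ℕ)) =
        Real.Gamma (ν + m + r + 1) := by
      push_cast
      ring_nf
    have h3 : Real.Gamma (ν + (2 * m + r + 1 : ℕ) - m) = Real.Gamma (ν + m + r + 1) := by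
      push_cast
      ring_nf
    have hr : ((r + 1).factorial : ℝ) = (r + 1) * (r.factorial : ℝ) := by
      rw [Nat.factorial_succ]; push_cast; ring
    have hr' : (r.factorial : ℝ) ≠ 0 := by positivity
    rw [h1, h2, h3, e1, e2, e3, hm, hr]
    push_cast
    field_simp
    ring

theorem gegenbauer_add_two {ν : ℝ} (hν : 0 < ν) (x : ℝ) (n : ℕ) :
    ((n : ℝ) + 2) * gegenbauer ν (n + 2) x =
      2 * (n + 1 + ν) * x * gegenbauer ν (n + 1) x - (n + 2 * ν) * gegenbauer ν n x := by
  rw [gegenbauer_eq_sum_term ν x (n := n + 2) (L := n + 2 + 1) (by omega),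
    gegenbauer_eq_sum_term ν x (n := n + 1) (L := n + 2 + 1) (by omega),
    gegenbauer_eq_sum_term ν x (n := n) (L := n + 2) (by omega),
    Finset.sum_range_succ', Finset.sum_range_succ' _ (n + 2), mul_add, mul_add,
    gegenbauerTerm_zero_recurrence hν, Finset.mul_sum, Finset.mul_sum, Finset.mul_sum,
    add_sub_right_comm, ← Finset.sum_sub_distrib]
  simp only [gegenbauerTerm_succ_recurrence hν]

theorem gegenbauer_eq_gegenbauerRec {ν : ℝ} (hν : 0 < ν) (x : ℝ) (n : ℕ) :
    gegenbauer ν n x = gegenbauerRec ν x (n + 1) := by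
  have hΓ := (Real.Gamma_pos_of_pos hν).ne'
  refine eq_gegenbauerRec (f := fun k => Nat.casesOn k 0 fun m => gegenbauer ν m x) rfl ?_ ?_
    (n + 1)
  · simp [gegenbauer, hΓ]
  · rintro (_ | k)
    · have h1 : Real.Gamma (ν + 1) = ν * Real.Gamma ν := Real.Gamma_add_one hν.ne'
      simp [gegenbauer, hΓ, h1]
      ring
    · have := gegenbauer_add_two hν x k
      push_cast
      linear_combination this

/-- `(n + ν) C_n^ν = ν (C_n^{ν+1} - C_{n-2}^{ν+1})`. -/
theorem gegenbauerRec_param_sub {ν : ℝ} (hν : 0 < ν) (x : ℝ) (n : ℕ) :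
    ((n : ℝ) + 1 + ν) * gegenbauerRec ν x (n + 2) =
      ν * (gegenbauerRec (ν + 1) x (n + 2) - gegenbauerRec (ν + 1) x n) := by
  induction n using Nat.twoStepInduction with
  | zero =>
    simp [gegenbauerRec]
    ring
  | one =>
    simp [gegenbauerRec]
    ring
  | more n ih ih' =>
    have hH := gegenbauerRec_add_two ν x (n + 2)
    have hK := gegenbauerRec_add_two (ν + 1) x (n + 2)
    have hK' := gegenbauerRec_add_two (ν + 1) x n
    have h1 : (n : ℝ) + 3 ≠ 0 := by positivity
    have h2 : (n : ℝ) + 1 + ν ≠ 0 := by positivity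
    apply mul_left_cancel₀ h1
    apply mul_left_cancel₀ h2
    push_cast at *
    simp only [add_assoc, Nat.reduceAdd] at *
    linear_combination (n + 3 + ν) * (n + 1 + ν) * hH + (n + 3 + ν) * (n + 1 + ν) * 2 * x * ih' -
      (n + 3 + ν) * (n + 1 + 2 * ν) * ih - ν * (n + 1 + ν) * hK + ν * (n + 3 + ν) * hK'

theorem gegenbauerRec_lower_param {ν : ℝ} (hν : 0 < ν) (x : ℝ) (n : ℕ) :
    ((n : ℝ) + 1) * gegenbauerRec ν x (n + 2) =
      2 * ν * (x * gegenbauerRec (ν + 1) x (n + 1) - gegenbauerRec (ν + 1) x n) := by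
  have h1 := gegenbauerRec_param_sub hν x n
  have h2 := gegenbauerRec_add_two (ν + 1) x n
  have h : (n : ℝ) + 1 + ν ≠ 0 := by positivity
  apply mul_left_cancel₀ h
  linear_combination ((n : ℝ) + 1) * h1 + ν * h2

theorem gegenbauerRec_raise_param {ν : ℝ} (hν : 0 < ν) (x : ℝ) (n : ℕ) :
    2 * ν * (1 - x ^ 2) * gegenbauerRec (ν + 1) x n =
      (n + 2 * ν - 1) * gegenbauerRec ν x n - n * x * gegenbauerRec ν x (n + 1) := by
  match n with
  | 0 => simp [gegenbauerRec]
  | 1 =>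
    simp [gegenbauerRec]
    ring
  | n + 2 =>
    have h1 := gegenbauerRec_lower_param hν x n
    have h2 := gegenbauerRec_lower_param hν x (n + 1)
    have hK := gegenbauerRec_add_two (ν + 1) x n
    have h : (n : ℝ) + 1 ≠ 0 := by positivity
    apply mul_left_cancel₀ h
    push_cast at *
    simp only [add_assoc, Nat.reduceAdd] at *
    linear_combination -(n + 1 + 2 * ν) * h1 + (n + 1) * x * h2 + 2 * ν * hK

/-- The coefficients of the addition theorem, up to normalization. -/
noncomputable def additionCoeff (ν w x y : ℝ) (j M : ℕ) : ℝ :=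
  4 ^ j * ((M - 1).factorial : ℝ) / Real.Gamma ((M : ℝ) - 1 + 2 * j + 2 * ν) *
    ((ascPochhammer ℝ j).eval ν) ^ 2 * w ^ j *
    gegenbauerRec (ν + j) x M * gegenbauerRec (ν + j) y M

theorem additionCoeff_zero (ν w x y : ℝ) (j : ℕ) : additionCoeff ν w x y j 0 = 0 := by
  simp [additionCoeff, gegenbauerRec_zero]

theorem additionCoeff_recurrence_top {ν : ℝ} (hν : 0 < ν) (w x y : ℝ) (N : ℕ) :
    ((N : ℝ) + 1) * (2 * ν + 2 * (N + 1 : ℕ) - 1) * additionCoeff ν w x y (N + 1) 1 =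
      2 * (N + ν) * w * (N + 1) * additionCoeff ν w x y N 1 := by
  have hΓ : Real.Gamma (2 * N + 2 * ν) ≠ 0 := (Real.Gamma_pos_of_pos (by positivity)).ne'
  have h1 : Real.Gamma (2 * N + 2 * ν + 1) = (2 * N + 2 * ν) * Real.Gamma (2 * N + 2 * ν) :=
    Real.Gamma_add_one (by positivity)
  have h2 : Real.Gamma (2 * N + 2 * ν + 1 + 1) =
      (2 * N + 2 * ν + 1) * Real.Gamma (2 * N + 2 * ν + 1) :=
    Real.Gamma_add_one (by positivity)
  have e1 : (((1 : ℕ) : ℝ) - 1 + 2 * (N + 1 : ℕ) + 2 * ν) = 2 * N + 2 * ν + 1 + 1 := by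
    push_cast; ring
  have e2 : (((1 : ℕ) : ℝ) - 1 + 2 * N + 2 * ν) = 2 * N + 2 * ν := by
    push_cast; ring
  simp only [additionCoeff, gegenbauerRec_one, e1, e2, h2, h1, ascPochhammer_succ_eval]
  push_cast
  have h3 : (2 * N + 2 * ν : ℝ) ≠ 0 := by positivity
  have h4 : (2 * N + 2 * ν + 1 : ℝ) ≠ 0 := by positivity
  field_simp
  ring

theorem additionCoeff_add_two (ν w x y : ℝ) (j m : ℕ) :
    additionCoeff ν w x y j (m + 2) =
      4 ^ j * ((ascPochhammer ℝ j).eval ν) ^ 2 * w ^ j / Real.Gamma (m + 2 * (ν + j) + 1) *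
        ((m.factorial : ℝ) / (m + 1) *
          ((2 * (m + (ν + j)) * x * gegenbauerRec (ν + j) x (m + 1) -
              (m + 2 * (ν + j) - 1) * gegenbauerRec (ν + j) x m) *
            (2 * (m + (ν + j)) * y * gegenbauerRec (ν + j) y (m + 1) -
              (m + 2 * (ν + j) - 1) * gegenbauerRec (ν + j) y m))) := by
  have hm : (m : ℝ) + 1 ≠ 0 := by positivity
  have e : ((m + 2 : ℕ) : ℝ) - 1 + 2 * j + 2 * ν = m + 2 * (ν + j) + 1 := by push_cast; ring
  rw [← gegenbauerRec_add_two, ← gegenbauerRec_add_two, additionCoeff, e,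
    show m + 2 - 1 = m + 1 by omega, Nat.factorial_succ]
  push_cast
  field_simp

theorem additionCoeff_add_one {ν : ℝ} (hν : 0 < ν) (w x y : ℝ) (j m : ℕ) :
    additionCoeff ν w x y j (m + 1) =
      4 ^ j * ((ascPochhammer ℝ j).eval ν) ^ 2 * w ^ j / Real.Gamma (m + 2 * (ν + j) + 1) *
        ((m + 2 * (ν + j)) * (m.factorial : ℝ) *
          (gegenbauerRec (ν + j) x (m + 1) * gegenbauerRec (ν + j) y (m + 1))) := by
  have hz : 0 < (m : ℝ) + 2 * (ν + j) := by positivity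
  have hΓ := (Real.Gamma_pos_of_pos hz).ne'
  have e : ((m + 1 : ℕ) : ℝ) - 1 + 2 * j + 2 * ν = m + 2 * (ν + j) := by push_cast; ring
  rw [additionCoeff, e, Nat.add_sub_cancel, Real.Gamma_add_one hz.ne']
  field_simp

theorem Gamma_add_one_eq_mul_Gamma_sub_one {z : ℝ} (hz : 1 < z) :
    Real.Gamma (z + 1) = z * (z - 1) * Real.Gamma (z - 1) := by
  have h := Real.Gamma_add_one (s := z - 1) (by linarith)
  rw [sub_add_cancel] at h
  rw [Real.Gamma_add_one (by linarith), h, mul_assoc]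

theorem additionCoeff_eq {ν : ℝ} (hν : 1 / 2 < ν) (w x y : ℝ) (j m : ℕ) :
    additionCoeff ν w x y j m =
      4 ^ j * ((ascPochhammer ℝ j).eval ν) ^ 2 * w ^ j / Real.Gamma (m + 2 * (ν + j) + 1) *
        ((m + 2 * (ν + j)) * (m + 2 * (ν + j) - 1) * ((m - 1).factorial : ℝ) *
          (gegenbauerRec (ν + j) x m * gegenbauerRec (ν + j) y m)) := by
  have hz : 1 < (m : ℝ) + 2 * (ν + j) := by
    have : (0 : ℝ) ≤ m + 2 * j := by positivity
    linarith
  have hΓ := (Real.Gamma_pos_of_pos (sub_pos.2 hz)).ne'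
  have h0 : (m : ℝ) + 2 * (ν + j) ≠ 0 := by linarith
  have h1 := (sub_pos.2 hz).ne'
  have e : (m : ℝ) - 1 + 2 * j + 2 * ν = m + 2 * (ν + j) - 1 := by ring
  rw [additionCoeff, e, Gamma_add_one_eq_mul_Gamma_sub_one hz]
  field_simp

theorem mul_additionCoeff_pred {ν : ℝ} (hν : 1 / 2 < ν) (w x y : ℝ) (j m : ℕ) :
    w * (j * additionCoeff ν w x y (j - 1) (m + 1 + j - (j - 1))) =
      4 ^ j * ((ascPochhammer ℝ j).eval ν) ^ 2 * w ^ j / Real.Gamma (m + 2 * (ν + j) + 1) *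
        ((m + 2 * (ν + j)) * (m + 2 * (ν + j) - 1) * j * ((m.factorial : ℝ) / (m + 1)) *
          ((x * gegenbauerRec (ν + j) x (m + 1) - gegenbauerRec (ν + j) x m) *
            (y * gegenbauerRec (ν + j) y (m + 1) - gegenbauerRec (ν + j) y m))) := by
  rcases j with _ | j
  · simp
  have hz : 1 < (m : ℝ) + 2 * (ν + (j + 1 : ℕ)) := by
    have : (0 : ℝ) ≤ m + 2 * (j + 1 : ℕ) := by positivity
    linarith
  have hΓ := (Real.Gamma_pos_of_pos (sub_pos.2 hz)).ne'
  have h0 : (m : ℝ) + 2 * (ν + (j + 1 : ℕ)) ≠ 0 := by linarith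
  have h1 := (sub_pos.2 hz).ne'
  have hm : (m : ℝ) + 1 ≠ 0 := by positivity
  have hνj : 0 < ν + j := by positivity
  have lower (t : ℝ) : gegenbauerRec (ν + j) t (m + 2) = 2 * (ν + j) *
      (t * gegenbauerRec (ν + (j + 1 : ℕ)) t (m + 1) - gegenbauerRec (ν + (j + 1 : ℕ)) t m) /
        (m + 1) := by
    rw [eq_div_iff hm, mul_comm, gegenbauerRec_lower_param hνj, Nat.cast_succ, add_assoc]
  have e : ((m + 2 : ℕ) : ℝ) - 1 + 2 * j + 2 * ν = m + 2 * (ν + (j + 1 : ℕ)) - 1 := by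
    push_cast; ring
  rw [Nat.add_sub_cancel, show m + 1 + (j + 1) - j = m + 2 by omega, additionCoeff, e,
    Gamma_add_one_eq_mul_Gamma_sub_one hz, lower, lower, show m + 2 - 1 = m + 1 by omega,
    Nat.factorial_succ, ascPochhammer_succ_eval]
  generalize gegenbauerRec (ν + (j + 1 : ℕ)) = H
  generalize Real.Gamma (m + 2 * (ν + (j + 1 : ℕ)) - 1) = g at *
  generalize (m : ℝ) + 2 * (ν + (j + 1 : ℕ)) = z at *
  push_cast
  field_simp
  ring

theorem mul_additionCoeff_succ {ν : ℝ} (hν : 0 < ν) {w x y : ℝ}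
    (hw : w ^ 2 = (1 - x ^ 2) * (1 - y ^ 2)) (j m : ℕ) :
    w * additionCoeff ν w x y (j + 1) m =
      4 ^ j * ((ascPochhammer ℝ j).eval ν) ^ 2 * w ^ j / Real.Gamma (m + 2 * (ν + j) + 1) *
        (((m - 1).factorial : ℝ) *
          (((m + 2 * (ν + j) - 1) * gegenbauerRec (ν + j) x m -
              m * x * gegenbauerRec (ν + j) x (m + 1)) *
            ((m + 2 * (ν + j) - 1) * gegenbauerRec (ν + j) y m -
              m * y * gegenbauerRec (ν + j) y (m + 1)))) := by
  have hνj : 0 < ν + j := by positivity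
  have e : (m : ℝ) - 1 + 2 * (j + 1 : ℕ) + 2 * ν = m + 2 * (ν + j) + 1 := by push_cast; ring
  rw [← gegenbauerRec_raise_param hνj, ← gegenbauerRec_raise_param hνj, additionCoeff, e,
    ascPochhammer_succ_eval, Nat.cast_succ, ← add_assoc]
  linear_combination (4 ^ (j + 1) * ((m - 1).factorial : ℝ) / Real.Gamma (m + 2 * (ν + j) + 1) *
    ((ascPochhammer ℝ j).eval ν * (ν + j)) ^ 2 * w ^ j * gegenbauerRec (ν + j + 1) x m *
    gegenbauerRec (ν + j + 1) y m) * hw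

theorem additionCoeff_recurrence_of_le {ν : ℝ} (hν : 1 / 2 < ν) {w x y : ℝ}
    (hw : w ^ 2 = (1 - x ^ 2) * (1 - y ^ 2)) (j m : ℕ) :
    ((j : ℝ) + m + 1) * (2 * ν + 2 * j - 1) * additionCoeff ν w x y j (m + 2) =
      2 * (j + m + ν) * (x * y * (2 * ν + 2 * j - 1) * additionCoeff ν w x y j (m + 1) +
        (w * (j * additionCoeff ν w x y (j - 1) (m + 1 + j - (j - 1))) +
          (j + 2 * ν - 1) * (w * additionCoeff ν w x y (j + 1) m))) -
      (j + m - 1 + 2 * ν) * (2 * ν + 2 * j - 1) * additionCoeff ν w x y j m := by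
  have hν0 : 0 < ν := by linarith
  rw [additionCoeff_add_two, additionCoeff_add_one hν0, mul_additionCoeff_pred hν,
    mul_additionCoeff_succ hν0 hw, additionCoeff_eq hν w x y j m]
  generalize 4 ^ j * ((ascPochhammer ℝ j).eval ν) ^ 2 * w ^ j /
    Real.Gamma (m + 2 * (ν + j) + 1) = K
  rcases m with _ | k
  · simp only [gegenbauerRec_zero]
    push_cast
    simp
    ring
  · have hk : (k : ℝ) + 1 + 1 ≠ 0 := by positivity
    rw [Nat.add_sub_cancel, Nat.factorial_succ]
    push_cast
    field_simp
    ring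

theorem additionCoeff_recurrence {ν : ℝ} (hν : 1 / 2 < ν) {w x y : ℝ}
    (hw : w ^ 2 = (1 - x ^ 2) * (1 - y ^ 2)) {N j : ℕ} (hj : j < N + 2) :
    ((N : ℝ) + 1) * (2 * ν + 2 * j - 1) * additionCoeff ν w x y j (N + 2 - j) =
      2 * (N + ν) * (x * y * (2 * ν + 2 * j - 1) * additionCoeff ν w x y j (N + 1 - j) +
        w * (j * additionCoeff ν w x y (j - 1) (N + 1 - (j - 1)) +
          (j + 2 * ν - 1) * additionCoeff ν w x y (j + 1) (N + 1 - (j + 1)))) -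
      (N - 1 + 2 * ν) * (2 * ν + 2 * j - 1) * additionCoeff ν w x y j (N - j) := by
  rcases Nat.lt_succ_iff_lt_or_eq.1 hj with h | rfl
  · obtain ⟨m, rfl⟩ := Nat.exists_eq_add_of_le (Nat.lt_succ_iff.1 h)
    have := additionCoeff_recurrence_of_le hν hw j m
    have e1 : j + m + 2 - j = m + 2 := by omega
    have e2 : j + m + 1 - j = m + 1 := by omega
    have e3 : j + m + 1 - (j - 1) = m + 1 + j - (j - 1) := by omega
    have e4 : j + m + 1 - (j + 1) = m := by omega
    rw [e1, e2, e3, e4, Nat.add_sub_cancel_left]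
    push_cast
    linear_combination this
  · have := additionCoeff_recurrence_top (show 0 < ν by linarith) w x y N
    have e1 : N + 2 - (N + 1) = 1 := by omega
    have e2 : N + 1 - (N + 1 - 1) = 1 := by omega
    have e3 : N + 1 - (N + 1 + 1) = 0 := by omega
    have e4 : N - (N + 1) = 0 := by omega
    rw [e1, e2, e3, e4, Nat.sub_self, Nat.add_sub_cancel]
    simp only [additionCoeff_zero]
    push_cast at *
    linear_combination this

theorem sum_mul_gegenbauerRec_mul_arg (ν ζ : ℝ) {b : ℕ → ℝ} {L : ℕ} (hb : ∀ j, L ≤ j → b j = 0) :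
    ζ * ∑ j ∈ range (L + 1), (2 * ν + 2 * j - 1) * b j * gegenbauerRec (ν - 1 / 2) ζ (j + 1) =
      ∑ j ∈ range (L + 1), (j * b (j - 1) + (j + 2 * ν - 1) * b (j + 1)) *
        gegenbauerRec (ν - 1 / 2) ζ (j + 1) := by
  set q := gegenbauerRec (ν - 1 / 2) ζ with hq
  have key : ∀ j ∈ range (L + 1), ζ * ((2 * ν + 2 * j - 1) * b j * q (j + 1)) =
      ((j + 1 : ℕ) : ℝ) * b (j + 1 - 1) * q (j + 1 + 1) + (j + 2 * ν - 2) * b j * q j := by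
    intro j _
    have := gegenbauerRec_add_two (ν - 1 / 2) ζ j
    rw [← hq] at this
    push_cast
    linear_combination (-b j) * this
  rw [Finset.mul_sum, Finset.sum_congr rfl key, Finset.sum_add_distrib]
  simp only [add_mul, Finset.sum_add_distrib]
  congr 1
  · rw [Finset.sum_range_succ, Finset.sum_range_succ', Nat.add_sub_cancel, hb L le_rfl]
    simp
  · rw [Finset.sum_range_succ', Finset.sum_range_succ _ L, hb (L + 1) (by omega), hq,
      gegenbauerRec_zero]
    simp only [mul_zero, zero_mul, add_zero]
    refine Finset.sum_congr rfl fun j _ => ?_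
    push_cast
    ring

theorem additionCoeff_sum_recurrence {ν : ℝ} (hν : 1 / 2 < ν) {w x y : ℝ}
    (hw : w ^ 2 = (1 - x ^ 2) * (1 - y ^ 2)) (ζ : ℝ) {S : ℕ → ℝ}
    (hS : ∀ M, S M = ∑ j ∈ range M, (2 * ν + 2 * j - 1) * additionCoeff ν w x y j (M - j) *
      gegenbauerRec (ν - 1 / 2) ζ (j + 1)) (N : ℕ) :
    ((N : ℝ) + 1) * S (N + 2) =
      2 * (N + ν) * (x * y + w * ζ) * S (N + 1) - (N + 2 * ν - 1) * S N := by
  have hext : ∀ {M L : ℕ}, M ≤ L → S M = ∑ j ∈ range L, (2 * ν + 2 * j - 1) *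
      additionCoeff ν w x y j (M - j) * gegenbauerRec (ν - 1 / 2) ζ (j + 1) := by
    intro M L h
    rw [hS]
    refine Finset.sum_subset (Finset.range_subset_range.2 h) fun j _ hj => ?_
    rw [Finset.mem_range, not_lt] at hj
    rw [Nat.sub_eq_zero_of_le hj, additionCoeff_zero]
    ring
  have hζ := sum_mul_gegenbauerRec_mul_arg ν ζ (L := N + 1)
    (b := fun j => additionCoeff ν w x y j (N + 1 - j)) (fun j hj => by
      simp only [Nat.sub_eq_zero_of_le hj, additionCoeff_zero])
  rw [← hext (by omega)] at hζ
  have h : 2 * (N + ν) * (x * y + w * ζ) * S (N + 1) =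
      2 * (N + ν) * (x * y) * S (N + 1) + 2 * (N + ν) * w * (ζ * S (N + 1)) := by ring
  rw [h, hζ, hext (M := N + 2) le_rfl, hext (M := N + 1) (L := N + 2) (by omega),
    hext (M := N) (L := N + 2) (by omega)]
  simp only [Finset.mul_sum]
  rw [← Finset.sum_add_distrib, ← Finset.sum_sub_distrib]
  refine Finset.sum_congr rfl fun j hj => ?_
  have := additionCoeff_recurrence hν hw (Finset.mem_range.1 hj)
  linear_combination gegenbauerRec (ν - 1 / 2) ζ (j + 1) * this

theorem gegenbauerRec_addition {ν : ℝ} (hν : 1 / 2 < ν) {w x y : ℝ}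
    (hw : w ^ 2 = (1 - x ^ 2) * (1 - y ^ 2)) (ζ : ℝ) (M : ℕ) :
    gegenbauerRec ν (x * y + w * ζ) M =
      Real.Gamma (2 * ν - 1) * ∑ j ∈ range M, (2 * ν + 2 * j - 1) *
        additionCoeff ν w x y j (M - j) * gegenbauerRec (ν - 1 / 2) ζ (j + 1) := by
  symm
  refine eq_gegenbauerRec (f := fun M => Real.Gamma (2 * ν - 1) * ∑ j ∈ range M,
    (2 * ν + 2 * j - 1) * additionCoeff ν w x y j (M - j) *
      gegenbauerRec (ν - 1 / 2) ζ (j + 1)) ?_ ?_ ?_ M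
  · simp
  · have h0 : 2 * ν - 1 ≠ 0 := by linarith
    have h1 : Real.Gamma (2 * ν) = (2 * ν - 1) * Real.Gamma (2 * ν - 1) := by
      rw [← Real.Gamma_add_one h0]; ring_nf
    have h2 : Real.Gamma (2 * ν - 1) ≠ 0 := (Real.Gamma_pos_of_pos (by linarith)).ne'
    simp [additionCoeff, gegenbauerRec_one, h1]
    field_simp
  · intro N
    have := additionCoeff_sum_recurrence hν hw ζ (fun _ => rfl) N
    linear_combination Real.Gamma (2 * ν - 1) * this

/-- Addition theorem for the Gegenbauer polynomials. -/
theorem gegenbauer_addition_theorem (ν : ℝ) (hν : 1 / 2 < ν) (n : ℕ)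
    (x y : ℝ) (hx : x ∈ Set.Icc (-1 : ℝ) 1) (hy : y ∈ Set.Icc (-1 : ℝ) 1) (ζ : ℝ) :
    gegenbauer ν n (x * y + Real.sqrt (1 - x ^ 2) * Real.sqrt (1 - y ^ 2) * ζ) =
      Real.Gamma (2 * ν - 1) *
        ∑ j ∈ Finset.range (n + 1),
          4 ^ j * ((n - j).factorial : ℝ) / Real.Gamma ((n : ℝ) + 2 * ν + j) *
            ((ascPochhammer ℝ j).eval ν) ^ 2 * (2 * ν + 2 * (j : ℝ) - 1) *
            Real.sqrt (1 - x ^ 2) ^ j * Real.sqrt (1 - y ^ 2) ^ j *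
            gegenbauer (ν + j) (n - j) x * gegenbauer (ν + j) (n - j) y *
            gegenbauer (ν - 1 / 2) j ζ := by
  have hw : (Real.sqrt (1 - x ^ 2) * Real.sqrt (1 - y ^ 2)) ^ 2 = (1 - x ^ 2) * (1 - y ^ 2) := by
    rw [mul_pow, Real.sq_sqrt (by nlinarith [hx.1, hx.2]), Real.sq_sqrt (by nlinarith [hy.1, hy.2])]
  rw [gegenbauer_eq_gegenbauerRec (by linarith), gegenbauerRec_addition hν hw]
  congr 1
  refine Finset.sum_congr rfl fun j hj => ?_
  have hjn : j ≤ n := Nat.lt_succ_iff.1 (Finset.mem_range.1 hj)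
  have hpos : 0 < ν + j := by positivity
  have e : n + 1 - j = n - j + 1 := by omega
  have e' : ((n - j + 1 : ℕ) : ℝ) - 1 + 2 * j + 2 * ν = n + 2 * ν + j := by
    push_cast [Nat.cast_sub hjn]
    ring
  rw [gegenbauer_eq_gegenbauerRec hpos, gegenbauer_eq_gegenbauerRec hpos,
    gegenbauer_eq_gegenbauerRec (by linarith), additionCoeff, e, e', Nat.add_sub_cancel, mul_pow]
  ring
end

section
/- Addition theorem for Legendre polynomials: for x, y ∈ [−1,1] and ζ ∈ [−1,1], P_n(xy + √(1−x²)√(1−y²)·ζ) = P_n(x)P_n(y) + 2∑_{j=1}^{n} ((n−j)!/(n+j)!) P_n^j(x) P_n^j(y) T_j(ζ), where P_n^j(x) = (−1)^j (1−x²)^{j/2} (d/dx)^j P_n(x) are the associated Legendre functions and T_j is the Chebyshev polynomial of the first kind. -/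
open Finset Real
/-- The Legendre polynomial `P_n = C_n^{1/2}`. -/
noncomputable def legendre (n : ℕ) (x : ℝ) : ℝ := gegenbauer (1 / 2) n x

/-- The associated Legendre function `P_n^j(x) = (-1)^j (1-x²)^{j/2} (d/dx)^j P_n(x)`. -/
noncomputable def assocLegendre (n j : ℕ) (x : ℝ) : ℝ :=
  (-1 : ℝ) ^ j * Real.sqrt (1 - x ^ 2) ^ j * iteratedDeriv j (legendre n) x

open Polynomial in
theorem coeff_linear_pow {K : Type*} [CommRing K] (p q : K) (a i : ℕ) :
    ((C p * X + C q) ^ a).coeff i = (a.choose i : K) * p ^ i * q ^ (a - i) := by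
  have h : (C p * X + C q) ^ a = ((X + C q) ^ a).comp (C p * X) := by simp
  rw [h, comp_C_mul_X_coeff, coeff_X_add_C_pow]
  ring

theorem choose_mul_choose_mul_factorial (i u v e : ℕ) :
    (i + u).choose i * (v + e).choose v * ((i + v).factorial * (u + e).factorial) =
      (i + u).factorial * (v + e).factorial * ((i + v).choose i * (u + e).choose u) := by
  have h (a b : ℕ) : (a + b).choose a * a.factorial * b.factorial = (a + b).factorial := by
    simpa using Nat.choose_mul_factorial_mul_factorial (Nat.le_add_right a b)
  rw [← h i v, ← h u e, ← h i u, ← h v e]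
  ring

open Polynomial in
theorem coeff_linear_pow_mul_linear_pow {K : Type*} [CommRing K] (p q r s : K) {a b c : ℕ} {m : ℕ}
    (hm : min a c ≤ m) :
    ((C p * X + C q) ^ a * (C r * X + C s) ^ b).coeff c =
      ∑ i ∈ range (m + 1), if i ≤ a ∧ i ≤ c then
        (a.choose i : K) * p ^ i * q ^ (a - i) *
          ((b.choose (c - i) : K) * r ^ (c - i) * s ^ (b - (c - i))) else 0 := by
  rw [coeff_mul, Nat.sum_antidiagonal_eq_sum_range_succ_mk, ← sum_filter]
  simp only [coeff_linear_pow]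
  symm
  apply sum_subset_zero_on_sdiff
  · intro i hi
    simp only [mem_filter, mem_range] at hi ⊢
    omega
  · intro i hi
    simp only [mem_sdiff, mem_filter, mem_range] at hi
    rw [Nat.choose_eq_zero_of_lt (by omega)]
    simp
  · simp

open Polynomial in
/-- Duality between the two ways of extracting a coefficient from products of powers of the
linear forms given by the rows and by the columns of a `2 × 2` matrix. -/
theorem coeff_linear_pow_mul_linear_pow_transpose {K : Type*} [CommRing K] (p q r s : K)
    {a b c d : ℕ} (h : a + b = c + d) :
    ((C p * X + C q) ^ a * (C r * X + C s) ^ b).coeff c * ((c.factorial : K) * d.factorial) =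
      (a.factorial : K) * b.factorial * ((C p * X + C r) ^ c * (C q * X + C s) ^ d).coeff a := by
  rw [coeff_linear_pow_mul_linear_pow p q r s (le_refl (min a c)),
    coeff_linear_pow_mul_linear_pow p r q s (le_of_eq (min_comm c a)), sum_mul, mul_sum]
  refine sum_congr rfl fun i hi => ?_
  have hi' : i ≤ a ∧ i ≤ c := by
    rw [mem_range] at hi
    omega
  rw [if_pos hi', if_pos hi'.symm]
  obtain ⟨u, rfl⟩ := Nat.exists_eq_add_of_le hi'.1
  obtain ⟨v, rfl⟩ := Nat.exists_eq_add_of_le hi'.2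
  simp only [Nat.add_sub_cancel_left]
  by_cases hv : v ≤ b
  · obtain ⟨e, rfl⟩ := Nat.exists_eq_add_of_le hv
    obtain rfl : d = u + e := by omega
    have key := congrArg (Nat.cast : ℕ → K) (choose_mul_choose_mul_factorial i u v e)
    push_cast at key
    simp only [Nat.add_sub_cancel_left]
    linear_combination (p ^ i * q ^ u * r ^ v * s ^ e) * key
  · rw [Nat.choose_eq_zero_of_lt (by omega : b < v), Nat.choose_eq_zero_of_lt (by omega : d < u)]
    simp

theorem sum_range_two_mul_add_one {M : Type*} [AddCommMonoid M] (f : ℕ → M) (n : ℕ) :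
    ∑ i ∈ range (2 * n + 1), f i = f n + ∑ j ∈ Icc 1 n, (f (n + j) + f (n - j)) := by
  have hIcc (g : ℕ → M) : ∑ j ∈ Icc 1 n, g j = ∑ j ∈ range n, g (j + 1) := by
    rw [range_eq_Ico, sum_Ico_add' g 0 n 1]
    rfl
  rw [hIcc, sum_add_distrib, show 2 * n + 1 = n + (n + 1) by ring, sum_range_add, sum_range_succ',
    ← sum_range_reflect f n]
  have : ∀ j, f (n - 1 - j) = f (n - (j + 1)) := fun j => by congr 1; omega
  simp only [this, add_zero]
  abel

open Polynomial in
theorem sum_coeff_mul_pow_mul_pow_mul {R A : Type*} [CommRing R] [CommRing A] [Algebra R A]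
    (f : R[X]) {d : ℕ} (hf : f.natDegree ≤ d) (n : ℕ) (u v : A) :
    (∑ i ∈ range (d + 1), algebraMap R A (f.coeff i) * (u ^ i * v ^ (d - i))) ^ n =
      ∑ i ∈ range (n * d + 1),
        algebraMap R A ((f ^ n).coeff i) * (u ^ i * v ^ (n * d - i)) := by
  have h (g : R[X]) (m : ℕ) : MvPolynomial.aeval ![u, v] (g.homogenize m) =
      ∑ i ∈ range (m + 1), algebraMap R A (g.coeff i) * (u ^ i * v ^ (m - i)) := by
    rw [homogenize, _root_.map_sum, Nat.sum_antidiagonal_eq_sum_range_succ_mk]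
    refine sum_congr rfl fun i _ => ?_
    simp [MvPolynomial.aeval_monomial, Finsupp.prod_fintype]
  have hp : (f ^ n).homogenize (n * d) = f.homogenize d ^ n := by
    have := homogenize_finsetProd (s := range n) (p := fun _ => f) (n := fun _ => d)
      (fun _ _ => hf)
    simpa using this
  rw [← h, ← h, hp, map_pow]

/-- The coefficient of `h ^ m` in `((x + h) ^ 2 - 1) ^ n`. -/
noncomputable def rodriguesCoeff {K : Type*} [CommRing K] (n m : ℕ) (x : K) : K :=
  ((Polynomial.X ^ 2 + Polynomial.C (2 * x) * Polynomial.X + Polynomial.C (x ^ 2 - 1)) ^ n).coeff m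

theorem map_rodriguesCoeff {K L : Type*} [CommRing K] [CommRing L] (f : K →+* L) (n m : ℕ) (x : K) :
    f (rodriguesCoeff n m x) = rodriguesCoeff n m (f x) := by
  simp [rodriguesCoeff, ← Polynomial.coeff_map, map_ofNat]

open Polynomial in
theorem coeff_quadratic_pow_add {K : Type*} [Field K] {α β x : K} (h : α * β = x ^ 2 - 1)
    (n k : ℕ) :
    ((C α * X ^ 2 + C (2 * x) * X + C β) ^ n).coeff (n + k) =
      α ^ k * rodriguesCoeff n (n + k) x := by
  by_cases hα : α = 0
  · subst hα
    rw [zero_mul] at h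
    rw [rodriguesCoeff, ← h]
    have h₁ : (X ^ 2 + C (2 * x) * X + C 0) ^ n = X ^ n * (C 1 * X + C (2 * x)) ^ n := by
      rw [← mul_pow]
      congr 1
      simp only [map_one, map_zero]
      ring
    rw [h₁, add_comm n k, coeff_X_pow_mul, coeff_linear_pow]
    simp only [map_zero, zero_mul, zero_add, coeff_linear_pow]
    rcases Nat.eq_zero_or_pos k with rfl | hk
    · simp
    · simp [Nat.choose_eq_zero_of_lt (show n < k + n by omega), hk.ne']
  · have h₁ : C (α ^ n) * (C α * X ^ 2 + C (2 * x) * X + C β) ^ n =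
        ((X ^ 2 + C (2 * x) * X + C (x ^ 2 - 1)) ^ n).comp (C α * X) := by
      rw [C_pow, ← mul_pow, pow_comp, ← h]
      congr 1
      simp
      ring
    have h₂ := congrArg (fun f => coeff f (n + k)) h₁
    simp only [coeff_C_mul, comp_C_mul_X_coeff] at h₂
    apply mul_left_cancel₀ (pow_ne_zero n hα)
    rw [h₂, rodriguesCoeff]
    ring

open Polynomial in
theorem reflect_quadratic {K : Type*} [CommRing K] (α β x : K) :
    reflect 2 (C α * X ^ 2 + C x * X + C β) = C β * X ^ 2 + C x * X + C α := by
  have hX : reflect 2 (X : K[X]) = X := by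
    simpa [revAt_le] using reflect_monomial 2 1 (R := K)
  rw [reflect_add, reflect_add, reflect_C_mul, reflect_C_mul, reflect_monomial, reflect_C, hX,
    revAt_le le_rfl]
  simp only [Nat.sub_self]
  ring

open Polynomial in
theorem reflect_pow {R : Type*} [CommSemiring R] (f : R[X]) {d : ℕ} (hf : f.natDegree ≤ d) (n : ℕ) :
    reflect (n * d) (f ^ n) = reflect d f ^ n := by
  induction n with
  | zero => simp
  | succ n ih =>
    rw [pow_succ, add_one_mul, reflect_mul _ _ (natDegree_pow_le_of_le n hf) hf, ih, pow_succ]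

open Polynomial in
theorem coeff_quadratic_pow_sub {K : Type*} [Field K] {α β x : K} (h : α * β = x ^ 2 - 1)
    {n k : ℕ} (hk : k ≤ n) :
    ((C α * X ^ 2 + C (2 * x) * X + C β) ^ n).coeff (n - k) =
      β ^ k * rodriguesCoeff n (n + k) x := by
  have hq : (C α * X ^ 2 + C (2 * x) * X + C β).natDegree ≤ 2 := natDegree_quadratic_le
  rw [← coeff_quadratic_pow_add (mul_comm α β ▸ h), ← reflect_quadratic α β,
    ← reflect_pow _ hq, coeff_reflect, revAt_le (by omega)]
  congr 1
  omega

open Polynomial in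
theorem sum_coeff_quadratic_mul {K A : Type*} [CommRing K] [CommRing A] [Algebra K A]
    (a b c : K) (u v : A) :
    ∑ i ∈ range (2 + 1), algebraMap K A ((C a * X ^ 2 + C b * X + C c).coeff i) *
        (u ^ i * v ^ (2 - i)) =
      algebraMap K A a * u ^ 2 + algebraMap K A b * (u * v) + algebraMap K A c * v ^ 2 := by
  simp only [sum_range_succ, range_zero, sum_empty, coeff_add, coeff_C_mul, coeff_X_pow, coeff_X,
    coeff_C]
  simp
  ring

open Polynomial in
theorem rodriguesCoeff_addition {K : Type*} [Field K] [CharZero K] (n : ℕ) {x s p r w : K}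
    (hs : s ^ 2 = 1 - x ^ 2) (hpr : p ^ 2 + r ^ 2 = 1) (hw : w ≠ 0) :
    2 ^ n * (n.factorial : K) ^ 2 *
        rodriguesCoeff n n (x * (p ^ 2 - r ^ 2) + s * (2 * p * r) * ((w + w⁻¹) / 2)) =
      (n.factorial : K) ^ 2 * rodriguesCoeff n n x * rodriguesCoeff n n (p ^ 2 - r ^ 2) +
        ∑ j ∈ Icc 1 n, ((n + j).factorial : K) * (n - j).factorial *
          rodriguesCoeff n (n + j) x * rodriguesCoeff n (n + j) (p ^ 2 - r ^ 2) *
            (s * (2 * p * r)) ^ j * (w ^ j + w⁻¹ ^ j) := by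
  set y := p ^ 2 - r ^ 2 with hy
  set z := x * y + s * (2 * p * r) * ((w + w⁻¹) / 2) with hz
  set Q : K[X] := C (-(s * w)) * X ^ 2 + C (2 * x) * X + C (s * w⁻¹) with hQ
  set Y : K[X] := C (-(2 * p * r)) * X ^ 2 + C (2 * y) * X + C (2 * p * r) with hY
  have hαβ : -(s * w) * (s * w⁻¹) = x ^ 2 - 1 := by
    field_simp
    linear_combination -hs
  have hY' : -(2 * p * r) * (2 * p * r) = y ^ 2 - 1 := by
    linear_combination (-(p ^ 2 + r ^ 2) - 1) * hpr
  have hzw : 2 * z = 2 * x * y + s * w * (2 * p * r) + s * w⁻¹ * (2 * p * r) := by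
    rw [hz]
    field_simp
    ring
  let α' := -(s * w) * p ^ 2 + 2 * x * (p * r) + s * w⁻¹ * r ^ 2
  let β' := -(s * w) * r ^ 2 - 2 * x * (p * r) + s * w⁻¹ * p ^ 2
  have hα'β' : α' * β' = z ^ 2 - 1 := by
    have h4 : 4 * (α' * β') = (2 * z) ^ 2 - 4 := by
      rw [hzw, hy]
      simp only [α', β']
      linear_combination (4 * (p ^ 2 + r ^ 2) ^ 2) * hαβ - 4 * (p ^ 2 + r ^ 2 + 1) * hpr
    have : (4 : K) ≠ 0 := by norm_num
    apply mul_left_cancel₀ this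
    rw [h4]
    ring
  have hsub : ∑ i ∈ range (2 + 1), algebraMap K K[X] (Q.coeff i) *
      ((C p * X + C (-r)) ^ i * (C r * X + C p) ^ (2 - i)) =
        C α' * X ^ 2 + C (2 * z) * X + C β' := by
    rw [hQ, sum_coeff_quadratic_mul, hzw, hy]
    simp only [α', β', algebraMap_eq, map_add, map_sub, map_mul, map_neg, map_pow, C_ofNat]
    ring
  have hcol (i : ℕ) (hi : i ≤ 2 * n) :
      2 ^ n * (n.factorial : K) ^ 2 *
        ((C p * X + C (-r)) ^ i * (C r * X + C p) ^ (2 * n - i)).coeff n =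
      (i.factorial : K) * (2 * n - i).factorial * (Y ^ n).coeff i := by
    have h1 := coeff_linear_pow_mul_linear_pow_transpose p (-r) r p
      (show i + (2 * n - i) = n + n by omega)
    have h2 : Y ^ n = C (2 ^ n) * ((C p * X + C r) ^ n * (C (-r) * X + C p) ^ n) := by
      rw [C_pow, ← mul_pow, ← mul_pow]
      congr 1
      rw [hY, hy]
      simp only [map_neg, map_mul, map_sub, map_pow, C_ofNat]
      ring
    rw [h2, coeff_C_mul]
    linear_combination 2 ^ n * h1
  have hmain := congrArg (fun f => coeff f n)
    (sum_coeff_mul_pow_mul_pow_mul Q natDegree_quadratic_le n (C p * X + C (-r)) (C r * X + C p))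
  rw [hsub] at hmain
  simp only [finsetSum_coeff, algebraMap_eq, coeff_C_mul] at hmain
  have hz0 := coeff_quadratic_pow_add hα'β' n 0
  rw [add_zero, pow_zero, one_mul] at hz0
  rw [← hz0, hmain, mul_sum, mul_comm n 2]
  have hterm : ∀ i ∈ range (2 * n + 1), 2 ^ n * (n.factorial : K) ^ 2 * ((Q ^ n).coeff i *
      ((C p * X + C (-r)) ^ i * (C r * X + C p) ^ (2 * n - i)).coeff n) =
        (i.factorial : K) * (2 * n - i).factorial * (Q ^ n).coeff i * (Y ^ n).coeff i := by
    intro i hi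
    rw [mem_range] at hi
    linear_combination (Q ^ n).coeff i * hcol i (by omega)
  rw [sum_congr rfl hterm, sum_range_two_mul_add_one]
  congr 1
  · have h1 := coeff_quadratic_pow_add hαβ n 0
    have h2 := coeff_quadratic_pow_add hY' n 0
    rw [add_zero, pow_zero, one_mul] at h1 h2
    rw [h1, h2, show 2 * n - n = n by omega]
    ring
  · refine sum_congr rfl fun j hj => ?_
    have hjn := (mem_Icc.mp hj).2
    rw [coeff_quadratic_pow_add hαβ, coeff_quadratic_pow_add hY', coeff_quadratic_pow_sub hαβ hjn,
      coeff_quadratic_pow_sub hY' hjn, show 2 * n - (n + j) = n - j by omega,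
      show 2 * n - (n - j) = n + j by omega, neg_pow (s * w), neg_pow (2 * p * r)]
    have : ((-1 : K) ^ j) * (-1) ^ j = 1 := by rw [← mul_pow]; simp
    simp only [mul_pow]
    linear_combination ((n + j).factorial : K) * (n - j).factorial *
      rodriguesCoeff n (n + j) x * rodriguesCoeff n (n + j) y * s ^ j * w ^ j * 2 ^ j * p ^ j *
        r ^ j * this

theorem Gamma_half_add_nat (k : ℕ) :
    Real.Gamma (1 / 2 + k) * (4 ^ k * k.factorial) = (2 * k).factorial * Real.Gamma (1 / 2) := by
  induction k with
  | zero => simp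
  | succ k ih =>
    have h : (1 / 2 + ((k + 1 : ℕ) : ℝ)) = (1 / 2 + k) + 1 := by push_cast; ring
    rw [h, Real.Gamma_add_one (by positivity), show 2 * (k + 1) = 2 * k + 1 + 1 by ring,
      Nat.factorial_succ, Nat.factorial_succ, Nat.factorial_succ]
    push_cast
    linear_combination (2 * k + 1 : ℝ) * (2 * k + 2) * ih

open Polynomial in
theorem legendre_eq_rodrigues (n : ℕ) (x : ℝ) :
    legendre n x = (2 ^ n * n.factorial : ℝ)⁻¹ *
      (derivative^[n] ((X ^ 2 - 1 : ℝ[X]) ^ n)).eval x := by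
  have hexp : (X ^ 2 - 1 : ℝ[X]) ^ n =
      ∑ m ∈ range (n + 1), C ((-1 : ℝ) ^ m * n.choose m) * X ^ (2 * (n - m)) := by
    rw [sub_eq_neg_add, add_pow]
    refine sum_congr rfl fun m _ => ?_
    simp only [map_mul, map_pow, map_neg, map_one, map_natCast, ← pow_mul]
    ring
  rw [hexp, iterate_derivative_sum, eval_finsetSum, mul_sum, legendre, gegenbauer]
  simp only [iterate_derivative_C_mul, iterate_derivative_X_pow_eq_C_mul, eval_mul, eval_C,
    eval_pow, eval_X]
  have hsub : range (n / 2 + 1) ⊆ range (n + 1) := by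
    intro i hi
    simp only [mem_range] at hi ⊢
    omega
  rw [← sum_subset hsub]
  · refine sum_congr rfl fun m hm => ?_
    rw [mem_range] at hm
    obtain ⟨d, rfl⟩ : ∃ d, n = 2 * m + d := ⟨n - 2 * m, by omega⟩
    have hG := Gamma_half_add_nat (m + d)
    have hc : ((2 * m + d).choose m : ℝ) * m.factorial * (m + d).factorial =
        (2 * m + d).factorial := by
      have := Nat.choose_mul_factorial_mul_factorial (show m ≤ 2 * m + d by omega)
      rw [show 2 * m + d - m = m + d by omega] at this
      exact_mod_cast this
    have hd : ((2 * (m + d)).descFactorial (2 * m + d) : ℝ) * d.factorial =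
        (2 * (m + d)).factorial := by
      have := Nat.factorial_mul_descFactorial (show 2 * m + d ≤ 2 * (m + d) by omega)
      rw [show 2 * (m + d) - (2 * m + d) = d by omega] at this
      rw [mul_comm]
      exact_mod_cast this
    rw [show 2 * m + d - m = m + d by omega, show 2 * m + d - 2 * m = d by omega,
      show 2 * (m + d) - (2 * m + d) = d by omega,
      show (1 / 2 : ℝ) + ((2 * m + d : ℕ) : ℝ) - m = 1 / 2 + ((m + d : ℕ) : ℝ) by
        push_cast; ring]
    have h0 : Real.Gamma (1 / 2) ≠ 0 := (Real.Gamma_pos_of_pos (by norm_num)).ne'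
    have h4 : (4 : ℝ) ^ (m + d) = 2 ^ (2 * m + d) * 2 ^ d := by
      rw [show (4 : ℝ) = 2 ^ 2 by norm_num, ← pow_mul, ← pow_add]
      congr 1
      ring
    have hm0 : (m.factorial : ℝ) ≠ 0 := by positivity
    have hd0 : (d.factorial : ℝ) ≠ 0 := by positivity
    have hmd0 : ((m + d).factorial : ℝ) ≠ 0 := by positivity
    have hc0 : ((2 * m + d).choose m : ℝ) ≠ 0 :=
      Nat.cast_ne_zero.mpr (Nat.choose_pos (by omega)).ne'
    rw [← hd, h4] at hG
    have hG' := eq_div_of_mul_eq (by positivity) hG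
    rw [hG', ← hc, mul_pow]
    field_simp
  · intro m hm hm'
    simp only [mem_range] at hm hm'
    rw [Nat.descFactorial_eq_zero_iff_lt.mpr (by omega)]
    simp

open Polynomial in
theorem iteratedDeriv_polynomial (f : ℝ[X]) (j : ℕ) :
    iteratedDeriv j (fun x => f.eval x) = fun x => (derivative^[j] f).eval x := by
  induction j with
  | zero => simp
  | succ j ih =>
    rw [iteratedDeriv_succ, ih, Function.iterate_succ_apply']
    ext x
    exact Polynomial.deriv _

open Polynomial in
theorem iteratedDeriv_legendre (n j : ℕ) (x : ℝ) :
    iteratedDeriv j (legendre n) x =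
      (n + j).factorial / (2 ^ n * n.factorial) * rodriguesCoeff n (n + j) x := by
  have h : legendre n = fun x =>
      (C (2 ^ n * n.factorial : ℝ)⁻¹ * derivative^[n] ((X ^ 2 - 1 : ℝ[X]) ^ n)).eval x := by
    ext x
    rw [legendre_eq_rodrigues, eval_mul, eval_C]
  have hT : taylor x ((X ^ 2 - 1 : ℝ[X]) ^ n) =
      (X ^ 2 + C (2 * x) * X + C (x ^ 2 - 1)) ^ n := by
    rw [taylor_pow]
    congr 1
    simp [taylor_apply, C_ofNat]
    ring
  rw [h, iteratedDeriv_polynomial]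
  simp only [iterate_derivative_C_mul, eval_mul, eval_C]
  rw [← Function.iterate_add_apply, ← factorial_smul_hasseDeriv, rodriguesCoeff, ← hT,
    taylor_coeff, add_comm j n]
  rw [LinearMap.smul_apply, eval_smul]
  simp only [nsmul_eq_mul, div_eq_mul_inv]
  ring

/-- Addition theorem for the Legendre polynomials. -/
theorem legendre_addition_theorem (n : ℕ) (x y ζ : ℝ)
    (hx : x ∈ Set.Icc (-1 : ℝ) 1) (hy : y ∈ Set.Icc (-1 : ℝ) 1)
    (hζ : ζ ∈ Set.Icc (-1 : ℝ) 1) :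
    legendre n (x * y + Real.sqrt (1 - x ^ 2) * Real.sqrt (1 - y ^ 2) * ζ) =
      legendre n x * legendre n y +
        2 * ∑ j ∈ Finset.Icc 1 n,
          ((n - j).factorial : ℝ) / ((n + j).factorial : ℝ) *
            assocLegendre n j x * assocLegendre n j y *
            (Polynomial.Chebyshev.T ℝ j).eval ζ := by
  have hx2 : 0 ≤ 1 - x ^ 2 := by nlinarith [hx.1, hx.2]
  have hy1 : 0 ≤ (1 + y) / 2 := by linarith [hy.1]
  have hy2 : 0 ≤ (1 - y) / 2 := by linarith [hy.2]
  set s := √(1 - x ^ 2) with hs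
  set t := √(1 - y ^ 2) with ht
  have ht' : 2 * √((1 + y) / 2) * √((1 - y) / 2) = t := by
    rw [mul_assoc, ← Real.sqrt_mul hy1, ht,
      show 1 - y ^ 2 = 2 ^ 2 * ((1 + y) / 2 * ((1 - y) / 2)) by ring,
      Real.sqrt_mul (sq_nonneg 2), Real.sqrt_sq zero_le_two]
  have hp : √((1 + y) / 2) ^ 2 = (1 + y) / 2 := Real.sq_sqrt hy1
  have hr : √((1 - y) / 2) ^ 2 = (1 - y) / 2 := Real.sq_sqrt hy2
  have hs2 : s ^ 2 = 1 - x ^ 2 := Real.sq_sqrt hx2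
  generalize √((1 + y) / 2) = p at ht' hp
  generalize √((1 - y) / 2) = r at ht' hr
  set φ := Real.arccos ζ with hφ
  have hcos : Real.cos φ = ζ := Real.cos_arccos hζ.1 hζ.2
  have hw (j : ℕ) : Complex.exp (φ * Complex.I) ^ j + (Complex.exp (φ * Complex.I))⁻¹ ^ j =
      ((2 * (Polynomial.Chebyshev.T ℝ j).eval ζ : ℝ) : ℂ) := by
    rw [← hcos, Polynomial.Chebyshev.T_real_cos, ← Complex.exp_neg, ← Complex.exp_nat_mul,
      ← Complex.exp_nat_mul]
    push_cast
    rw [Complex.two_cos]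
    congr 2 <;> ring
  have hadd := rodriguesCoeff_addition (K := ℂ) n (x := x) (s := s) (p := p) (r := r)
    (w := Complex.exp (φ * Complex.I)) (by exact_mod_cast hs2)
    (by rw [← Complex.ofReal_pow, ← Complex.ofReal_pow, hp, hr]; push_cast; ring)
    (Complex.exp_ne_zero _)
  have hw1 := hw 1
  simp only [pow_one, Nat.cast_one, Polynomial.Chebyshev.T_one, Polynomial.eval_X] at hw1
  have hpy : (p : ℂ) ^ 2 - (r : ℂ) ^ 2 = (y : ℂ) := by
    rw [← Complex.ofReal_pow, ← Complex.ofReal_pow, hp, hr]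
    push_cast
    ring
  have hpt : 2 * (p : ℂ) * r = t := by exact_mod_cast ht'
  have hmap (m : ℕ) (a : ℝ) : rodriguesCoeff n m (a : ℂ) = (rodriguesCoeff n m a : ℝ) :=
    (map_rodriguesCoeff Complex.ofRealHom n m a).symm
  have hz : (x : ℂ) * y + s * t * (((2 * ζ : ℝ) : ℂ) / 2) = ((x * y + s * t * ζ : ℝ) : ℂ) := by
    push_cast
    ring
  simp only [hw, hw1, hpy, hpt, hz, hmap] at hadd
  have hreal : 2 ^ n * (n.factorial : ℝ) ^ 2 * rodriguesCoeff n n (x * y + s * t * ζ) =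
      (n.factorial : ℝ) ^ 2 * rodriguesCoeff n n x * rodriguesCoeff n n y +
        ∑ j ∈ Icc 1 n, ((n + j).factorial : ℝ) * (n - j).factorial *
          rodriguesCoeff n (n + j) x * rodriguesCoeff n (n + j) y *
            (s * t) ^ j * (2 * (Polynomial.Chebyshev.T ℝ j).eval ζ) := by
    exact_mod_cast hadd
  have hleg (a : ℝ) : legendre n a = rodriguesCoeff n n a / 2 ^ n := by
    have h := iteratedDeriv_legendre n 0 a
    rw [iteratedDeriv_zero, add_zero] at h
    rw [h]
    field_simp
  have hn : (n.factorial : ℝ) ≠ 0 := by positivity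
  have hfac : (2 ^ n * 2 ^ n * (n.factorial : ℝ) ^ 2) ≠ 0 := by positivity
  apply mul_left_cancel₀ hfac
  simp only [assocLegendre, iteratedDeriv_legendre, hleg, ← hs, ← ht]
  have hL : 2 ^ n * 2 ^ n * (n.factorial : ℝ) ^ 2 *
      (rodriguesCoeff n n (x * y + s * t * ζ) / 2 ^ n) =
        2 ^ n * (n.factorial : ℝ) ^ 2 * rodriguesCoeff n n (x * y + s * t * ζ) := by
    field_simp
  rw [hL, hreal, mul_add, mul_sum, mul_sum]
  congr 1
  · field_simp
  · refine sum_congr rfl fun j _ => ?_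
    have hnj : ((n + j).factorial : ℝ) ≠ 0 := by positivity
    have hsign : ((-1 : ℝ) ^ j) ^ 2 = 1 := by rw [← pow_mul, mul_comm, pow_mul]; simp
    field_simp
    rw [hsign]
    ring
end
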